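/- Under the same time-derivative Gaussian bound on Γ as above, there is C < ∞ such that for every α ∈ (0,1) there is c_α < ∞ with lim_{α↑1} c_α = 1 and, for all 0 < t ≤ t+h ≤ T and x ∈ ℝ^k, ∫₀^t ∫_{ℝ^k} |Γ(t+h,x;s,y) − Γ(t,x;s,y)| dy ds ≤ C c_α t^(1−α) h^α / (1−α). -/

import Mathlib

open MeasureTheory Set Filter

/-- Gaussian bound for the time derivative, at elapsed time `r` and displacement `z`. -/
noncomputable def gaussianBound (k : ℕ) (c C r : ℝ) (z : EuclideanSpace ℝ (Fin k)) : ℝ :=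
  C * r ^ (-((k : ℝ) + 2) / 2) * Real.exp (-c * ‖z‖ ^ 2 / r)

lemma lintegral_gaussianBound (k : ℕ) {c C r : ℝ} (hc : 0 < c) (hC : 0 < C) (hr : 0 < r)
    (x : EuclideanSpace ℝ (Fin k)) :
    ∫⁻ y, ENNReal.ofReal (gaussianBound k c C r (x - y))
      = ENNReal.ofReal (C * (Real.pi / c) ^ ((k : ℝ) / 2) * r⁻¹) := by
  have hb : 0 < c / r := by positivity
  have hexp : ∀ z : EuclideanSpace ℝ (Fin k),
      Real.exp (-c * ‖z‖ ^ 2 / r) = Real.exp (-(c / r) * ‖z‖ ^ 2) := fun z => by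
    congr 1; ring
  have hG := GaussianFourier.integral_rexp_neg_mul_sq_norm (V := EuclideanSpace ℝ (Fin k)) hb
  rw [finrank_euclideanSpace_fin] at hG
  have hI : Integrable fun v : EuclideanSpace ℝ (Fin k) => Real.exp (-(c / r) * ‖v‖ ^ 2) := by
    refine not_imp_comm.1 integral_undef ?_
    rw [hG]
    positivity
  rw [lintegral_sub_left_eq_self (fun z => ENNReal.ofReal (gaussianBound k c C r z)) x]
  simp only [gaussianBound, hexp]
  rw [← ofReal_integral_eq_lintegral_ofReal (hI.const_mul _)
    (Eventually.of_forall fun z => by positivity), integral_const_mul, hG]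
  congr 1
  have hsplit : Real.pi / (c / r) = Real.pi / c * r := by field_simp
  have hpow : r ^ (-((k : ℝ) + 2) / 2) * r ^ ((k : ℝ) / 2) = r⁻¹ := by
    rw [← Real.rpow_add hr, ← Real.rpow_neg_one]
    congr 1
    ring
  rw [hsplit, Real.mul_rpow (by positivity) hr.le, ← hpow]
  ring

lemma enorm_sub_le_lintegral_of_abs_deriv_le {f g : ℝ → ℝ} {a b : ℝ} (hab : a ≤ b)
    (hf : ∀ τ ∈ Icc a b, DifferentiableAt ℝ f τ) (hg : ContinuousOn g (Icc a b))
    (hfg : ∀ τ ∈ Icc a b, |deriv f τ| ≤ g τ) :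
    ‖f b - f a‖ₑ ≤ ∫⁻ τ in Ioc a b, ENNReal.ofReal (g τ) := by
  have hint : IntervalIntegrable (deriv f) volume a b := by
    refine (hg.intervalIntegrable_of_Icc hab).mono_fun
      (aestronglyMeasurable_deriv f _) ?_
    filter_upwards [ae_restrict_mem measurableSet_uIoc] with τ hτ
    rw [uIoc_of_le hab] at hτ
    exact (hfg τ (Ioc_subset_Icc_self hτ)).trans (le_abs_self _)
  rw [← intervalIntegral.integral_eq_sub_of_hasDerivAt
    (fun τ hτ => (hf τ (by rwa [uIcc_of_le hab] at hτ)).hasDerivAt) hint,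
    intervalIntegral.integral_of_le hab]
  refine (enorm_integral_le_lintegral_enorm _).trans
    (setLIntegral_mono' measurableSet_Ioc fun τ hτ => ?_)
  rw [Real.enorm_eq_ofReal_abs]
  exact ENNReal.ofReal_le_ofReal (hfg τ (Ioc_subset_Icc_self hτ))

lemma lintegral_sub_rpow_left {p a b : ℝ} (hp : -1 < p) (hab : a ≤ b) :
    ∫⁻ τ in Ioc a b, ENNReal.ofReal ((τ - a) ^ p)
      = ENNReal.ofReal ((b - a) ^ (p + 1) / (p + 1)) := by
  have hI : IntervalIntegrable (fun τ : ℝ => (τ - a) ^ p) volume a b := by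
    simpa using (intervalIntegral.intervalIntegrable_rpow' (a := 0) (b := b - a) hp).comp_sub_right a
  rw [← ofReal_integral_eq_lintegral_ofReal
    ((intervalIntegrable_iff_integrableOn_Ioc_of_le hab).1 hI), ← intervalIntegral.integral_of_le hab,
    intervalIntegral.integral_comp_sub_right (fun u : ℝ => u ^ p) a, integral_rpow (Or.inl hp),
    sub_self, Real.zero_rpow (by linarith), sub_zero]
  filter_upwards [ae_restrict_mem measurableSet_Ioc] with τ hτ
  exact Real.rpow_nonneg (sub_nonneg.2 hτ.1.le) _

lemma lintegral_sub_rpow_right {p a b : ℝ} (hp : -1 < p) (hab : a ≤ b) :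
    ∫⁻ τ in Ioc a b, ENNReal.ofReal ((b - τ) ^ p)
      = ENNReal.ofReal ((b - a) ^ (p + 1) / (p + 1)) := by
  have hI : IntervalIntegrable (fun τ : ℝ => (b - τ) ^ p) volume a b := by
    simpa using
      ((intervalIntegral.intervalIntegrable_rpow' (a := 0) (b := b - a) hp).comp_sub_left b).symm
  rw [← ofReal_integral_eq_lintegral_ofReal
    ((intervalIntegrable_iff_integrableOn_Ioc_of_le hab).1 hI), ← intervalIntegral.integral_of_le hab,
    intervalIntegral.integral_comp_sub_left (fun u : ℝ => u ^ p) b, integral_rpow (Or.inl hp),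
    sub_self, Real.zero_rpow (by linarith), sub_zero]
  filter_upwards [ae_restrict_mem measurableSet_Ioc] with τ hτ
  exact Real.rpow_nonneg (sub_nonneg.2 hτ.2) _

lemma inv_add_le_rpow_mul_rpow {u v α : ℝ} (hu : 0 < u) (hv : 0 < v) (h0 : 0 < α)
    (h1 : α < 1) : (u + v)⁻¹ ≤ u ^ (α - 1) * v ^ (-α) := by
  have huv : 0 < u + v := by positivity
  calc (u + v)⁻¹ = (u + v) ^ (α - 1) * (u + v) ^ (-α) := by
        rw [← Real.rpow_add huv, ← Real.rpow_neg_one]; congr 1; ring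
    _ ≤ u ^ (α - 1) * v ^ (-α) := by
        gcongr ?_ * ?_
        · exact Real.rpow_le_rpow_of_nonpos hu (by linarith) (by linarith)
        · exact Real.rpow_le_rpow_of_nonpos hv (by linarith) (by linarith)

theorem stmt_13 (k : ℕ) (hk : 1 ≤ k) (c C T : ℝ) (hc : 0 < c) (hC : 0 < C) (hT : 0 < T)
    (Γ : ℝ → EuclideanSpace ℝ (Fin k) → ℝ → EuclideanSpace ℝ (Fin k) → ℝ)
    (hdiff : ∀ s : ℝ, ∀ x y, ∀ τ : ℝ, 0 ≤ s → s < τ → τ ≤ T →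
      DifferentiableAt ℝ (fun τ' => Γ τ' x s y) τ)
    (hderiv : ∀ s : ℝ, ∀ x y, ∀ τ : ℝ, 0 ≤ s → s < τ → τ ≤ T →
      |deriv (fun τ' => Γ τ' x s y) τ|
        ≤ C * (τ - s) ^ (-((k : ℝ) + 2) / 2) * Real.exp (-c * ‖x - y‖ ^ 2 / (τ - s))) :
    ∃ C₀ : ℝ, 0 < C₀ ∧ ∃ cc : ℝ → ℝ,
      Tendsto cc (nhdsWithin 1 (Set.Iio 1)) (nhds 1) ∧
      ∀ α ∈ Set.Ioo (0:ℝ) 1, ∀ t h : ℝ, 0 < t → 0 ≤ h → t + h ≤ T →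
        ∀ x : EuclideanSpace ℝ (Fin k),
        (∫ s in Set.Ioc (0:ℝ) t,
            ∫ y : EuclideanSpace ℝ (Fin k), |Γ (t + h) x s y - Γ t x s y|)
          ≤ C₀ * cc α * t ^ (1 - α) * h ^ α / (1 - α) := by
  have hA : 0 < C * (Real.pi / c) ^ ((k : ℝ) / 2) := by positivity
  set A := C * (Real.pi / c) ^ ((k : ℝ) / 2)
  refine ⟨A, hA, fun α => α⁻¹, ?_, ?_⟩
  · simpa using ((continuousAt_inv₀ (one_ne_zero (α := ℝ))).tendsto).mono_left
      (nhdsWithin_le_nhds (s := Iio (1 : ℝ)))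
  rintro α ⟨h0, h1⟩ t h ht hh hT' x
  have hth : t ≤ t + h := by linarith
  have hinner : ∀ s ∈ Ioo 0 t,
      ‖∫ y : EuclideanSpace ℝ (Fin k), |Γ (t + h) x s y - Γ t x s y|‖ₑ
        ≤ ENNReal.ofReal (A * (h ^ α / α)) * ENNReal.ofReal ((t - s) ^ (-α)) := by
    intro s hs
    have hpos : ∀ τ ∈ Icc t (t + h), 0 < τ - s := fun τ hτ => by linarith [hs.2, hτ.1]
    have hmeas : Measurable (Function.uncurry fun (y : EuclideanSpace ℝ (Fin k)) (τ : ℝ) =>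
        ENNReal.ofReal (gaussianBound k c C (τ - s) (x - y))) := by
      unfold gaussianBound Function.uncurry
      fun_prop
    calc ‖∫ y : EuclideanSpace ℝ (Fin k), |Γ (t + h) x s y - Γ t x s y|‖ₑ
        ≤ ∫⁻ y, ‖|Γ (t + h) x s y - Γ t x s y|‖ₑ := enorm_integral_le_lintegral_enorm _
      _ ≤ ∫⁻ y, ∫⁻ τ in Ioc t (t + h), ENNReal.ofReal (gaussianBound k c C (τ - s) (x - y)) := by
          refine lintegral_mono fun y => ?_
          rw [← Real.norm_eq_abs, enorm_norm]
          refine enorm_sub_le_lintegral_of_abs_deriv_le (f := fun τ => Γ τ x s y) hth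
            (fun τ hτ => hdiff s x y τ hs.1.le (sub_pos.1 (hpos τ hτ)) (hτ.2.trans hT')) ?_
            (fun τ hτ => hderiv s x y τ hs.1.le (sub_pos.1 (hpos τ hτ)) (hτ.2.trans hT'))
          have hsub : ContinuousOn (fun τ : ℝ => τ - s) (Icc t (t + h)) := by fun_prop
          exact (continuousOn_const.mul
            (hsub.rpow_const fun τ hτ => Or.inl (hpos τ hτ).ne')).mul
            (Real.continuous_exp.comp_continuousOn
              (continuousOn_const.div hsub fun τ hτ => (hpos τ hτ).ne'))
      _ = ∫⁻ τ in Ioc t (t + h), ∫⁻ y, ENNReal.ofReal (gaussianBound k c C (τ - s) (x - y)) :=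
          lintegral_lintegral_swap hmeas.aemeasurable
      _ ≤ ∫⁻ τ in Ioc t (t + h),
            ENNReal.ofReal (A * (t - s) ^ (-α)) * ENNReal.ofReal ((τ - t) ^ (α - 1)) := by
          refine setLIntegral_mono' measurableSet_Ioc fun τ hτ => ?_
          have hts : 0 < t - s := sub_pos.2 hs.2
          rw [lintegral_gaussianBound k hc hC (hpos τ (Ioc_subset_Icc_self hτ)),
            ← ENNReal.ofReal_mul (by positivity)]
          refine ENNReal.ofReal_le_ofReal ?_
          have := inv_add_le_rpow_mul_rpow (sub_pos.2 hτ.1) hts h0 h1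
          rw [sub_add_sub_cancel] at this
          calc A * (τ - s)⁻¹ ≤ A * ((τ - t) ^ (α - 1) * (t - s) ^ (-α)) := by gcongr
            _ = A * (t - s) ^ (-α) * (τ - t) ^ (α - 1) := by ring
      _ = ENNReal.ofReal (A * (h ^ α / α)) * ENNReal.ofReal ((t - s) ^ (-α)) := by
          have hts : 0 < t - s := sub_pos.2 hs.2
          rw [lintegral_const_mul' _ _ ENNReal.ofReal_ne_top,
            lintegral_sub_rpow_left (by linarith) hth, sub_add_cancel, add_sub_cancel_left,
            ← ENNReal.ofReal_mul (by positivity), ← ENNReal.ofReal_mul (by positivity)]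
          congr 1
          ring
  have hmain : ‖∫ s in Ioc 0 t, ∫ y : EuclideanSpace ℝ (Fin k), |Γ (t + h) x s y - Γ t x s y|‖ₑ
      ≤ ENNReal.ofReal (A * α⁻¹ * t ^ (1 - α) * h ^ α / (1 - α)) := by
    calc _ ≤ ∫⁻ s in Ioc 0 t,
            ‖∫ y : EuclideanSpace ℝ (Fin k), |Γ (t + h) x s y - Γ t x s y|‖ₑ :=
          enorm_integral_le_lintegral_enorm _
      _ ≤ ∫⁻ s in Ioc 0 t,
            ENNReal.ofReal (A * (h ^ α / α)) * ENNReal.ofReal ((t - s) ^ (-α)) := by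
          rw [← restrict_Ioo_eq_restrict_Ioc]
          exact setLIntegral_mono' measurableSet_Ioo hinner
      _ = _ := by
          rw [lintegral_const_mul' _ _ ENNReal.ofReal_ne_top,
            lintegral_sub_rpow_right (by linarith) ht.le, ← ENNReal.ofReal_mul (by positivity),
            sub_zero, neg_add_eq_sub]
          congr 1
          ring
  rw [Real.enorm_eq_ofReal_abs, ENNReal.ofReal_le_ofReal_iff
    (div_nonneg (by positivity) (by linarith))] at hmain
  exact (le_abs_self _).trans hmain
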